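/- Let D ≥ 2 and let u, v ∈ S^{D−1} be unit vectors with ∠(u, v) = θ. Then the spherical lune {x ∈ S^{D−1} : ⟨x, u⟩ > 0 and ⟨x, v⟩ > 0} has surface measure σ_{D−1}({x ∈ S^{D−1} : ⟨x, u⟩ > 0 and ⟨x, v⟩ > 0}) = ((π − θ)/(2π)) · A_{D−1}. -/

import Mathlib

open scoped RealInnerProductSpace
open MeasureTheory Real InnerProductGeometry

/-- `sphereArea n = A_{n-1} = 2 π^{n/2} / Γ(n/2)`, the total surface area of the
unit sphere `S^{n-1} ⊂ ℝ^n`. -/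
noncomputable def sphereArea (n : ℕ) : ℝ :=
  2 * Real.pi ^ ((n : ℝ) / 2) / Real.Gamma ((n : ℝ) / 2)

/-- The surface-area measure `σ_{n-1}` on the unit sphere `S^{n-1} ⊂ ℝ^n`, obtained
from the Lebesgue measure on `ℝ^n` (so that the measure of a set `s` is `n` times the
Lebesgue measure of the cone over `s`). -/
noncomputable def surfaceMeasure (n : ℕ) :
    Measure (Metric.sphere (0 : EuclideanSpace ℝ (Fin n)) 1) :=
  (volume : Measure (EuclideanSpace ℝ (Fin n))).toSphere

open Set in
open scoped ENNReal in
/-- Integration in polar coordinates of a radial function over a planar sector `S` with set of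
directions `I ⊆ (-π, π)`. -/
lemma setLIntegral_sector_of_radial {S : Set (ℝ × ℝ)} (hS : MeasurableSet S) {I : Set ℝ}
    (hI : MeasurableSet I) (hIπ : I ⊆ Ioo (-π) π)
    (hSI : ∀ r > 0, ∀ φ ∈ Ioo (-π) π, (r * cos φ, r * sin φ) ∈ S ↔ φ ∈ I)
    {g : ℝ → ℝ≥0∞} (hg : Measurable g) :
    ∫⁻ p in S, g (p.1 ^ 2 + p.2 ^ 2) =
      volume I * ∫⁻ r in Ioi (0 : ℝ), ENNReal.ofReal r * g (r ^ 2) := by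
  rw [← lintegral_indicator hS, ← lintegral_comp_polarCoord_symm]
  have hpt : ∀ p ∈ polarCoord.target,
      ENNReal.ofReal p.1 • S.indicator (fun p ↦ g (p.1 ^ 2 + p.2 ^ 2)) (polarCoord.symm p) =
        (ENNReal.ofReal p.1 * g (p.1 ^ 2)) * I.indicator 1 p.2 := by
    rintro ⟨r, φ⟩ ⟨hr, hφ⟩
    have h := hSI r hr φ hφ
    have hsq : (r * cos φ) ^ 2 + (r * sin φ) ^ 2 = r ^ 2 := by
      linear_combination r ^ 2 * sin_sq_add_cos_sq φ
    by_cases hmem : φ ∈ I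
    · simp [indicator_of_mem (h.2 hmem), hmem, hsq]
    · simp [indicator_of_notMem (mt h.1 hmem), hmem]
  rw [setLIntegral_congr_fun polarCoord.open_target.measurableSet hpt, polarCoord_target,
    Measure.volume_eq_prod, ← Measure.prod_restrict,
    lintegral_prod_mul (f := fun r : ℝ ↦ ENNReal.ofReal r * g (r ^ 2))
      (g := I.indicator (1 : ℝ → ℝ≥0∞)) (by fun_prop)
      ((measurable_one.indicator hI).aemeasurable),
    lintegral_indicator_one hI, Measure.restrict_apply hI, inter_eq_left.2 hIπ, mul_comm]

section Cylinder

variable {E : Type*} [NormedAddCommGroup E] [InnerProductSpace ℝ E] [MeasurableSpace E]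
  [BorelSpace E] [FiniteDimensional ℝ E]

/-- Splitting off the first two coordinates in an orthonormal basis preserves the volume. -/
lemma exists_measurePreserving_coords {n : ℕ} (b : OrthonormalBasis (Fin (n + 2)) ℝ E) :
    ∃ T : E → (ℝ × ℝ) × (Fin n → ℝ), MeasurePreserving T ∧
      (∀ x, (T x).1 = (⟪x, b 0⟫, ⟪x, b 1⟫)) ∧
      ∀ x, ‖x‖ ^ 2 = (T x).1.1 ^ 2 + (T x).1.2 ^ 2 + ∑ i, (T x).2 i ^ 2 := by
  have h₁ := (PiLp.volume_preserving_ofLp (Fin (n + 2))).comp b.measurePreserving_repr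
  have h₂ := (volume_preserving_piFinSuccAbove (fun _ : Fin (n + 2) ↦ ℝ) 0).comp h₁
  have h₃ := ((MeasurePreserving.id (volume : Measure ℝ)).prod
    (volume_preserving_piFinSuccAbove (fun _ : Fin (n + 1) ↦ ℝ) 0)).comp h₂
  have h₄ := (volume_preserving_prodAssoc (α₁ := ℝ) (β₁ := ℝ) (γ₁ := Fin n → ℝ)).symm.comp h₃
  have hcoord : ∀ x i, b.repr x i = ⟪x, b i⟫ := fun x i ↦ by
    rw [b.repr_apply_apply, real_inner_comm]
  refine ⟨_, h₄, fun x ↦ ?_, fun x ↦ ?_⟩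
  · exact Prod.ext (hcoord x 0) (hcoord x 1)
  · rw [← b.repr.norm_map, EuclideanSpace.norm_sq_eq, Fin.sum_univ_succ, Fin.sum_univ_succ]
    simp only [Real.norm_eq_abs, sq_abs, ← add_assoc]
    rfl

open Set in
open scoped ENNReal in
/-- The part of the unit ball lying over a planar sector has volume proportional to the opening
angle of the sector. -/
lemma exists_volume_sector_inter_ball {n : ℕ} (b : OrthonormalBasis (Fin (n + 2)) ℝ E) :
    ∃ K : ℝ≥0∞, ∀ (S : Set (ℝ × ℝ)) (I : Set ℝ), MeasurableSet S → MeasurableSet I →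
      I ⊆ Ioo (-π) π →
      (∀ r > 0, ∀ φ ∈ Ioo (-π) π, (r * cos φ, r * sin φ) ∈ S ↔ φ ∈ I) →
      volume {x : E | (⟪x, b 0⟫, ⟪x, b 1⟫) ∈ S ∧ ‖x‖ < 1} = volume I * K := by
  obtain ⟨T, hT, hT₁, hT₂⟩ := exists_measurePreserving_coords b
  let g : (Fin n → ℝ) → ℝ → ℝ≥0∞ := fun z ↦ (Iio (1 - ∑ i, z i ^ 2)).indicator 1
  refine ⟨∫⁻ z, ∫⁻ r in Ioi (0 : ℝ), ENNReal.ofReal r * g z (r ^ 2), fun S I hS hI hIπ hSI ↦ ?_⟩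
  let B : Set ((ℝ × ℝ) × (Fin n → ℝ)) :=
    {q | q.1 ∈ S ∧ q.1.1 ^ 2 + q.1.2 ^ 2 + ∑ i, q.2 i ^ 2 < 1}
  have hB : MeasurableSet B :=
    (measurable_fst hS).inter <| measurableSet_lt (by fun_prop :
      Measurable fun q : (ℝ × ℝ) × (Fin n → ℝ) ↦ q.1.1 ^ 2 + q.1.2 ^ 2 + ∑ i, q.2 i ^ 2)
      measurable_const
  have hpre : {x : E | (⟪x, b 0⟫, ⟪x, b 1⟫) ∈ S ∧ ‖x‖ < 1} = T ⁻¹' B := by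
    ext x
    simp only [mem_ofPred_eq, mem_preimage, B, ← hT₂, ← hT₁, sq_lt_one_iff₀ (norm_nonneg x)]
  have hslice : ∀ z : Fin n → ℝ, volume ((fun p : ℝ × ℝ ↦ (p, z)) ⁻¹' B) =
      volume I * ∫⁻ r in Ioi (0 : ℝ), ENNReal.ofReal r * g z (r ^ 2) := fun z ↦ by
    rw [← setLIntegral_sector_of_radial hS hI hIπ hSI (measurable_one.indicator measurableSet_Iio),
      ← lintegral_indicator_one (measurable_prodMk_right hB), ← lintegral_indicator hS]
    refine lintegral_congr fun p ↦ ?_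
    by_cases hp : p ∈ S <;> simp [B, indicator, hp, lt_sub_iff_add_lt]
  rw [hpre, hT.measure_preimage hB.nullMeasurableSet, Measure.volume_eq_prod,
    Measure.prod_apply_symm hB, lintegral_congr hslice, lintegral_const_mul' _ _ ?_]
  exact ((measure_mono hIπ).trans_lt measure_Ioo_lt_top).ne

end Cylinder

/-- A unit vector `v` at angle `θ` from `u` is `cos θ • u + sin θ • w` for some unit vector `w`
orthogonal to `u`. -/
lemma exists_orthonormalBasis_polar {E : Type*} [NormedAddCommGroup E] [InnerProductSpace ℝ E]
    [FiniteDimensional ℝ E] {n : ℕ} (hn : Module.finrank ℝ E = n + 2) {u v : E} (hu : ‖u‖ = 1)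
    (hv : ‖v‖ = 1) : ∃ b : OrthonormalBasis (Fin (n + 2)) ℝ E,
      b 0 = u ∧ v = cos (angle u v) • b 0 + sin (angle u v) • b 1 := by
  have hcard : Module.finrank ℝ E = Fintype.card (Fin (n + 2)) := by simpa using hn
  have hcos : ⟪u, v⟫ = cos (angle u v) := by simp [cos_angle, hu, hv]
  set c := cos (angle u v)
  set s := sin (angle u v)
  have hcs : s ^ 2 + c ^ 2 = 1 := sin_sq_add_cos_sq _
  have horth : ⟪u, v - c • u⟫ = 0 := by simp [inner_sub_right, inner_smul_right, hu, hcos]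
  have hnorm : ‖v - c • u‖ ^ 2 = s ^ 2 := by
    rw [norm_sub_sq_real, inner_smul_right, real_inner_comm, hcos, norm_smul, hu, hv, mul_one,
      Real.norm_eq_abs, sq_abs]
    linear_combination -hcs
  by_cases hs : s = 0
  · have hou : Orthonormal ℝ (({0} : Set (Fin (n + 2))).domRestrict fun _ ↦ u) :=
      ⟨fun _ ↦ hu, fun i j hij ↦ (hij (Subsingleton.elim i j)).elim⟩
    obtain ⟨b, hb⟩ := hou.exists_orthonormalBasis_extension_of_card_eq hcard
    have hb0 : b 0 = u := hb 0 rfl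
    refine ⟨b, hb0, ?_⟩
    rw [hs, zero_smul, add_zero, hb0, ← sub_eq_zero, ← norm_eq_zero]
    simpa [hs] using hnorm
  · let f : Fin (n + 2) → E := fun i ↦ if i = 0 then u else s⁻¹ • (v - c • u)
    have hw : ‖s⁻¹ • (v - c • u)‖ = 1 := by
      rw [← sq_eq_sq₀ (norm_nonneg _) zero_le_one, norm_smul, mul_pow, hnorm, Real.norm_eq_abs,
        sq_abs]
      field_simp
    have hof : Orthonormal ℝ (({0, 1} : Set (Fin (n + 2))).domRestrict f) := by
      have huw : ⟪u, s⁻¹ • (v - c • u)⟫ = 0 := by rw [inner_smul_right, horth, mul_zero]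
      constructor
      · rintro ⟨i, rfl | rfl⟩ <;> simp [f, hu, hw]
      · rintro ⟨i, rfl | rfl⟩ ⟨j, rfl | rfl⟩ hij
        · exact (hij rfl).elim
        · simpa [f] using huw
        · rw [real_inner_comm]
          simpa [f] using huw
        · exact (hij rfl).elim
    obtain ⟨b, hb⟩ := hof.exists_orthonormalBasis_extension_of_card_eq hcard
    have hb0 : b 0 = u := hb 0 (by simp)
    have hb1 : b 1 = s⁻¹ • (v - c • u) := hb 1 (by simp)
    refine ⟨b, hb0, ?_⟩
    rw [hb0, hb1, smul_inv_smul₀ hs, add_sub_cancel]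

/-- On `(-π, π)`, the half-planes `0 < cos φ` and `0 < cos (φ - θ)` cut out an arc. -/
lemma cos_pos_and_cos_sub_pos_iff {θ φ : ℝ} (hθ : θ ∈ Set.Icc 0 π) (hφ : φ ∈ Set.Ioo (-π) π) :
    0 < cos φ ∧ 0 < cos (φ - θ) ↔ φ ∈ Set.Ioo (θ - π / 2) (π / 2) := by
  obtain ⟨hθ₀, hθ₁⟩ := hθ
  obtain ⟨hφ₀, hφ₁⟩ := hφ
  constructor
  · rintro ⟨h₁, h₂⟩
    have hlt : φ < π / 2 := by
      by_contra! h
      linarith [cos_nonpos_of_pi_div_two_le_of_le h (by linarith)]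
    have hgt : -(π / 2) < φ := by
      by_contra! h
      rw [← cos_neg] at h₁
      linarith [cos_nonpos_of_pi_div_two_le_of_le (x := -φ) (by linarith) (by linarith)]
    refine ⟨?_, hlt⟩
    by_contra! h
    rw [← cos_neg] at h₂
    linarith [cos_nonpos_of_pi_div_two_le_of_le (x := -(φ - θ)) (by linarith) (by linarith)]
  · rintro ⟨h₁, h₂⟩
    exact ⟨cos_pos_of_mem_Ioo ⟨by linarith, h₂⟩, cos_pos_of_mem_Ioo ⟨by linarith, by linarith⟩⟩

/-- The total mass of the surface measure is the surface area of the sphere. -/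
lemma natCast_mul_volume_ball_eq_sphereArea {n : ℕ} (hn : n ≠ 0) :
    (n : ENNReal) * volume (Metric.ball (0 : EuclideanSpace ℝ (Fin n)) 1) =
      ENNReal.ofReal (sphereArea n) := by
  have : Nonempty (Fin n) := Fin.pos_iff_nonempty.1 (Nat.pos_of_ne_zero hn)
  have hn' : (n : ℝ) / 2 ≠ 0 := by positivity
  have hΓ : Gamma ((n : ℝ) / 2) ≠ 0 := (Gamma_pos_of_pos (by positivity)).ne'
  rw [EuclideanSpace.volume_ball, ENNReal.ofReal_one, one_pow, one_mul, Fintype.card_fin,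
    ← ENNReal.ofReal_natCast, ← ENNReal.ofReal_mul (Nat.cast_nonneg _), sphereArea,
    Gamma_add_one hn', sqrt_eq_rpow, ← rpow_natCast, ← rpow_mul pi_nonneg, one_div_mul_eq_div]
  congr 1
  field_simp

/-- The open cone over `{x ∈ S | 0 < ⟪x, u⟫, 0 < ⟪x, v⟫}`, cut off by the unit ball. -/
lemma Ioo_smul_lune {E : Type*} [NormedAddCommGroup E] [InnerProductSpace ℝ E] (u v : E) :
    Set.image2 (· • ·) (Set.Ioo (0 : ℝ) 1) ((↑) '' {x : Metric.sphere (0 : E) 1 |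
      0 < ⟪(x : E), u⟫ ∧ 0 < ⟪(x : E), v⟫}) = {x : E | (0 < ⟪x, u⟫ ∧ 0 < ⟪x, v⟫) ∧ ‖x‖ < 1} := by
  ext x
  constructor
  · rintro ⟨r, ⟨hr₀, hr₁⟩, _, ⟨y, ⟨hyu, hyv⟩, rfl⟩, rfl⟩
    refine ⟨⟨?_, ?_⟩, ?_⟩
    · simpa [inner_smul_left] using mul_pos hr₀ hyu
    · simpa [inner_smul_left] using mul_pos hr₀ hyv
    · simpa [norm_smul, abs_of_pos hr₀] using hr₁
  · rintro ⟨⟨hxu, hxv⟩, hx⟩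
    have hx₀ : x ≠ 0 := by
      rintro rfl
      simp at hxu
    have hpos : 0 < ‖x‖ := norm_pos_iff.2 hx₀
    refine ⟨‖x‖, ⟨hpos, hx⟩, ‖x‖⁻¹ • x,
      ⟨⟨‖x‖⁻¹ • x, by simp [norm_smul, hpos.ne']⟩, ⟨?_, ?_⟩, rfl⟩, smul_inv_smul₀ hpos.ne' x⟩
    · simpa [inner_smul_left] using mul_pos (inv_pos.2 hpos) hxu
    · simpa [inner_smul_left] using mul_pos (inv_pos.2 hpos) hxv

theorem lune_surface_measure {D : ℕ} (hD : 2 ≤ D)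
    (u v : EuclideanSpace ℝ (Fin D)) (hu : ‖u‖ = 1) (hv : ‖v‖ = 1)
    (θ : ℝ) (hθ : angle u v = θ) :
    surfaceMeasure D
        {x : Metric.sphere (0 : EuclideanSpace ℝ (Fin D)) 1 |
          0 < ⟪(x : EuclideanSpace ℝ (Fin D)), u⟫ ∧ 0 < ⟪(x : EuclideanSpace ℝ (Fin D)), v⟫} =
      ENNReal.ofReal ((π - θ) / (2 * π) * sphereArea D) := by
  obtain ⟨n, rfl⟩ := Nat.exists_eq_add_of_le' hD
  have hθI : θ ∈ Set.Icc 0 π := hθ ▸ ⟨angle_nonneg u v, angle_le_pi u v⟩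
  obtain ⟨b, hbu, hbv⟩ := exists_orthonormalBasis_polar (n := n) (by simp) hu hv
  rw [hθ] at hbv
  obtain ⟨K, hK⟩ := exists_volume_sector_inter_ball b
  have hball : volume (Metric.ball (0 : EuclideanSpace ℝ (Fin (n + 2))) 1) =
      ENNReal.ofReal (2 * π) * K := by
    have h := hK Set.univ (Set.Ioo (-π) π) .univ measurableSet_Ioo subset_rfl (by simp)
    rw [Real.volume_Ioo, sub_neg_eq_add, ← two_mul] at h
    rw [← h]
    congr 1
    ext x
    simp
  have hlune : volume {x : EuclideanSpace ℝ (Fin (n + 2)) |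
      (0 < ⟪x, u⟫ ∧ 0 < ⟪x, v⟫) ∧ ‖x‖ < 1} = ENNReal.ofReal (π - θ) * K := by
    have h := hK {p | 0 < p.1 ∧ 0 < cos θ * p.1 + sin θ * p.2} (Set.Ioo (θ - π / 2) (π / 2))
      ((measurableSet_lt measurable_const measurable_fst).inter
        (measurableSet_lt measurable_const
          (by fun_prop : Measurable fun p : ℝ × ℝ ↦ cos θ * p.1 + sin θ * p.2))) measurableSet_Ioo
      (Set.Ioo_subset_Ioo (by linarith [hθI.1, pi_pos]) (by linarith [pi_pos]))
      (fun r hr φ hφ ↦ by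
        rw [← cos_pos_and_cos_sub_pos_iff hθI hφ, cos_sub, Set.mem_ofPred_eq,
          show cos θ * (r * cos φ) + sin θ * (r * sin φ) =
            r * (cos φ * cos θ + sin φ * sin θ) by ring, mul_pos_iff_of_pos_left hr,
          mul_pos_iff_of_pos_left hr])
    rw [Real.volume_Ioo, show π / 2 - (θ - π / 2) = π - θ by ring] at h
    rw [← h, hbv, ← hbu]
    simp only [inner_add_right, inner_smul_right, Set.mem_ofPred_eq]
  have hmeas : MeasurableSet {x : Metric.sphere (0 : EuclideanSpace ℝ (Fin (n + 2))) 1 |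
      0 < ⟪(x : EuclideanSpace ℝ (Fin (n + 2))), u⟫ ∧
        0 < ⟪(x : EuclideanSpace ℝ (Fin (n + 2))), v⟫} := by
    have hinner (w : EuclideanSpace ℝ (Fin (n + 2))) : MeasurableSet
        {x : Metric.sphere (0 : EuclideanSpace ℝ (Fin (n + 2))) 1 |
          0 < ⟪(x : EuclideanSpace ℝ (Fin (n + 2))), w⟫} :=
      (isOpen_lt continuous_const (by fun_prop)).measurableSet
    exact (hinner u).inter (hinner v)
  have hratio : ENNReal.ofReal ((π - θ) / (2 * π)) * ENNReal.ofReal (2 * π) =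
      ENNReal.ofReal (π - θ) := by
    rw [← ENNReal.ofReal_mul (div_nonneg (sub_nonneg.2 hθI.2) two_pi_pos.le),
      div_mul_cancel₀ _ two_pi_pos.ne']
  rw [surfaceMeasure, Measure.toSphere_apply' _ hmeas, ← Set.image2_smul, Ioo_smul_lune, hlune,
    finrank_euclideanSpace_fin, ENNReal.ofReal_mul (div_nonneg (sub_nonneg.2 hθI.2) two_pi_pos.le),
    ← natCast_mul_volume_ball_eq_sphereArea (by omega), hball, ← hratio]
  ring
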